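/- arXiv:2311.12680 — 3 statements merged into one kernel-verified Lean document; each statement's English description precedes it below -/
import Mathlib

section
/- Let G be a group acting freely on a set X, let φ be a group automorphism of G, and let Φ : X → X be a map satisfying Φ(g • x) = φ(g) • Φ(x) for all g ∈ G and x ∈ X. Assume Fix(Φ) is nonempty. Then Fix(φ) = {g ∈ G | g • Fix(Φ) = Fix(Φ)}, i.e. the fixed subgroup of φ is exactly the setwise G-stabiliser of Fix(Φ); moreover, for any g, h ∈ G the translates g • Fix(Φ) and h • Fix(Φ) are either equal or disjoint. -/
open scoped Pointwise

/-- The fixed-point set of a self-map. -/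
def fixSet {X : Type*} (Φ : X → X) : Set X := {x | Φ x = x}

/-- The fixed subgroup of a group automorphism. -/
def fixSubgroup {G : Type*} [Group G] (φ : G ≃* G) : Subgroup G where
  carrier := {g | φ g = g}
  one_mem' := map_one φ
  mul_mem' := by
    intro a b ha hb
    simp only [Set.mem_setOf_eq] at *
    rw [map_mul, ha, hb]
  inv_mem' := by
    intro a ha
    simp only [Set.mem_setOf_eq] at *
    rw [map_inv, ha]

theorem smul_fixSet_of_mem_fixSubgroup {G X : Type*} [Group G] [MulAction G X]
    {φ : G ≃* G} {Φ : X → X} (hint : ∀ (g : G) (x : X), Φ (g • x) = φ g • Φ x)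
    {g : G} (hg : g ∈ fixSubgroup φ) : g • fixSet Φ = fixSet Φ := by
  have smul_mem {k : G} (hk : k ∈ fixSubgroup φ) {x : X} (hx : x ∈ fixSet Φ) :
      k • x ∈ fixSet Φ := by
    change φ k = k at hk
    change Φ x = x at hx
    change Φ (k • x) = k • x
    rw [hint, hk, hx]
  ext x
  rw [Set.mem_smul_set_iff_inv_smul_mem]
  exact ⟨fun hx => by simpa using smul_mem hg hx, smul_mem (inv_mem hg)⟩

theorem mem_fixSubgroup_of_smul_mem_fixSet {G X : Type*} [Group G] [MulAction G X]
    (hfree : ∀ (g : G) (x : X), g • x = x → g = 1)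
    {φ : G ≃* G} {Φ : X → X} (hint : ∀ (g : G) (x : X), Φ (g • x) = φ g • Φ x)
    {g : G} {x : X} (hx : x ∈ fixSet Φ) (hgx : g • x ∈ fixSet Φ) : g ∈ fixSubgroup φ := by
  change Φ x = x at hx
  change Φ (g • x) = g • x at hgx
  rw [hint, hx] at hgx
  have h : g⁻¹ * φ g = 1 := hfree _ x (by rw [mul_smul, hgx, inv_smul_smul])
  exact (inv_mul_eq_one.mp h).symm

/-- If `G` acts freely on `X`, `Φ : X → X` intertwines the action with the
automorphism `φ`, and `Fix(Φ)` is nonempty, then `Fix(φ)` is exactly the setwise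
`G`-stabiliser of `Fix(Φ)`, and any two `G`-translates of `Fix(Φ)` are equal or disjoint. -/
theorem fixed_subgroup_eq_stabilizer {G X : Type*} [Group G] [MulAction G X]
    (hfree : ∀ (g : G) (x : X), g • x = x → g = 1)
    (φ : G ≃* G) (Φ : X → X)
    (hint : ∀ (g : G) (x : X), Φ (g • x) = φ g • Φ x)
    (hne : (fixSet Φ).Nonempty) :
    fixSubgroup φ = MulAction.stabilizer G (fixSet Φ) ∧
      ∀ g h : G, g • fixSet Φ = h • fixSet Φ ∨ Disjoint (g • fixSet Φ) (h • fixSet Φ) := by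
  refine ⟨?_, fun g h => ?_⟩
  · ext g
    rw [MulAction.mem_stabilizer_iff]
    refine ⟨smul_fixSet_of_mem_fixSubgroup hint, fun hg => ?_⟩
    obtain ⟨x, hx⟩ := hne
    exact mem_fixSubgroup_of_smul_mem_fixSet hfree hint hx (hg ▸ Set.smul_mem_smul_set hx)
  · rw [or_iff_not_imp_right, Set.not_disjoint_iff]
    rintro ⟨y, hgy, hhy⟩
    rw [Set.mem_smul_set_iff_inv_smul_mem] at hgy hhy
    have hmem : h⁻¹ * g ∈ fixSubgroup φ :=
      mem_fixSubgroup_of_smul_mem_fixSet hfree hint hgy (by simpa [mul_smul] using hhy)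
    have hfix := smul_fixSet_of_mem_fixSubgroup hint hmem
    rwa [mul_smul, inv_smul_eq_iff] at hfix
end

section
/- Let G be a group, φ a group automorphism of G, n a positive integer, and g ∈ G such that φ^n(x) = g * x * g⁻¹ for all x ∈ G, and assume g does not lie in the center of G. Let H be the double centralizer of the fixed subgroup, H = Z_G(Z_G(Fix(φ))). Then: (1) Fix(φ) ≤ H; (2) H is φ-invariant, i.e. φ(H) = H; and (3) H is a proper subgroup of G. -/
/-- The double centralizer of the fixed subgroup of an automorphism. -/
def doubleCentralizerFix {G : Type*} [Group G] (φ : G ≃* G) : Subgroup G :=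
  Subgroup.centralizer (Subgroup.centralizer (fixSubgroup φ : Set G) : Set G)

theorem mem_fixSubgroup {G : Type*} [Group G] {φ : G ≃* G} {x : G} :
    x ∈ fixSubgroup φ ↔ φ x = x :=
  Iff.rfl

theorem MulEquiv.map_centralizer {G G' : Type*} [Group G] [Group G'] (φ : G ≃* G')
    (S : Set G) :
    (Subgroup.centralizer S).map φ.toMonoidHom = Subgroup.centralizer (φ '' S) := by
  ext y
  obtain ⟨x, rfl⟩ := φ.surjective y
  simp [Subgroup.mem_map, Subgroup.mem_centralizer_iff, ← map_mul]

theorem map_fixSubgroup {G : Type*} [Group G] (φ : G ≃* G) :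
    φ '' (fixSubgroup φ : Set G) = fixSubgroup φ :=
  (Set.EqOn.image_eq fun _ hx => hx).trans (Set.image_id _)

theorem map_doubleCentralizerFix {G : Type*} [Group G] (φ : G ≃* G) :
    (doubleCentralizerFix φ).map φ.toMonoidHom = doubleCentralizerFix φ := by
  have hZ : φ '' (Subgroup.centralizer (fixSubgroup φ : Set G) : Set G) =
      Subgroup.centralizer (fixSubgroup φ : Set G) := by
    have := congrArg SetLike.coe (φ.map_centralizer (fixSubgroup φ))
    rwa [map_fixSubgroup] at this
  rw [doubleCentralizerFix, φ.map_centralizer, hZ]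

theorem pow_apply_of_mem_fixSubgroup {G : Type*} [Group G] {φ : MulAut G} {x : G}
    (hx : x ∈ fixSubgroup φ) (n : ℕ) : (φ ^ n) x = x := by
  induction n with
  | zero => rfl
  | succ k ih => rw [pow_succ, MulAut.mul_apply, mem_fixSubgroup.mp hx, ih]

/-- If `φ^n` is the inner automorphism by `g` and `g` is not central, then the
double centralizer `H = Z_G(Z_G(Fix φ))` contains `Fix(φ)`, is `φ`-invariant, and is a
proper subgroup of `G`. -/
theorem double_centralizer_properties {G : Type*} [Group G]
    (φ : MulAut G) (n : ℕ) (hn : 0 < n) (g : G)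
    (h : ∀ x : G, (φ ^ n) x = g * x * g⁻¹)
    (hg : g ∉ Subgroup.center G) :
    fixSubgroup (φ : G ≃* G) ≤ doubleCentralizerFix (φ : G ≃* G) ∧
      Subgroup.map (φ : G ≃* G).toMonoidHom (doubleCentralizerFix (φ : G ≃* G)) =
        doubleCentralizerFix (φ : G ≃* G) ∧
      doubleCentralizerFix (φ : G ≃* G) ≠ ⊤ := by
  refine ⟨Set.subset_centralizer_centralizer, map_doubleCentralizerFix φ, fun htop => hg ?_⟩
  have hgZ : g ∈ Subgroup.centralizer (fixSubgroup φ : Set G) := fun x hx =>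
    eq_mul_inv_iff_mul_eq.mp ((pow_apply_of_mem_fixSubgroup hx n).symm.trans (h x))
  exact Subgroup.mem_center_iff.mpr fun x =>
    ((htop ▸ Subgroup.mem_top x : x ∈ doubleCentralizerFix φ) g hgZ).symm
end

section
/- For every natural number g, there exist a finite simple graph Λ and a group automorphism φ of the right-angled Artin group A_Λ such that φ ∘ φ = id and the fixed subgroup Fix(φ) is isomorphic to the genus-g surface group. -/
/-- The relator set of the right-angled Artin group of a simple graph: commutators of
adjacent vertices. -/
def raagRels {V : Type*} (Λ : SimpleGraph V) : Set (FreeGroup V) :=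
  {r | ∃ v w : V, Λ.Adj v w ∧
    r = FreeGroup.of v * FreeGroup.of w * (FreeGroup.of v)⁻¹ * (FreeGroup.of w)⁻¹}

/-- The right-angled Artin group of a simple graph. -/
abbrev RAAG {V : Type*} (Λ : SimpleGraph V) : Type _ := PresentedGroup (raagRels Λ)

/-- The surface relator `[a₁,b₁][a₂,b₂]⋯[a_g,b_g]`, where the generator `a_i` is
`Sum.inl i` and `b_i` is `Sum.inr i`. -/
def surfaceRel (g : ℕ) : FreeGroup (Fin g ⊕ Fin g) :=
  ((List.finRange g).map fun i =>
    FreeGroup.of (Sum.inl i) * FreeGroup.of (Sum.inr i) *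
      (FreeGroup.of (Sum.inl i))⁻¹ * (FreeGroup.of (Sum.inr i))⁻¹).prod

/-- The genus-`g` surface group
`⟨a₁, b₁, …, a_g, b_g ∣ [a₁,b₁][a₂,b₂]⋯[a_g,b_g]⟩`. -/
abbrev SurfaceGroup (g : ℕ) : Type _ :=
  PresentedGroup ({surfaceRel g} : Set (FreeGroup (Fin g ⊕ Fin g)))

namespace Monoid.PushoutI

variable {P : Type*} [Group P] {Q : Subgroup P}

/-- The amalgamated product of two copies of a group over a subgroup. -/
abbrev Double (Q : Subgroup P) : Type _ := PushoutI (fun _ : Bool => Q.subtype)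

/-- `StartsWith i g` says that `g` has a nonempty reduced expression whose first letter
lies in the copy of `P` indexed by `i`. -/
inductive StartsWith : Bool → Double Q → Prop
  | single (i : Bool) (p : P) (hp : p ∉ Q) : StartsWith i (of (φ := fun _ => Q.subtype) i p)
  | cons (i : Bool) (p : P) (hp : p ∉ Q) (g : Double Q) (hg : StartsWith (!i) g) :
      StartsWith i (of (φ := fun _ => Q.subtype) i p * g)

theorem of_eq_base_of_mem {p : P} (hp : p ∈ Q) (i : Bool) :
    (of i p : Double Q) = base (fun _ : Bool => Q.subtype) ⟨p, hp⟩ :=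
  of_apply_eq_base (fun _ : Bool => Q.subtype) i ⟨p, hp⟩

theorem StartsWith.base_mul {i : Bool} {g : Double Q} (hg : StartsWith i g) (q : Q) :
    StartsWith i (base (fun _ : Bool => Q.subtype) q * g) := by
  have key (p : P) (hp : p ∉ Q) : (q : P) * p ∉ Q := fun h =>
    hp ((Subgroup.mul_mem_cancel_left Q q.2).1 h)
  cases hg with
  | single i p hp =>
    rw [← of_apply_eq_base (fun _ : Bool => Q.subtype) i q, ← map_mul]
    exact .single i _ (key p hp)
  | cons i p hp g hg =>
    rw [← of_apply_eq_base (fun _ : Bool => Q.subtype) i q, ← mul_assoc, ← map_mul]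
    exact .cons i _ (key p hp) g hg

theorem StartsWith.exists_word {i : Bool} {g : Double Q} (hg : StartsWith i g) :
    ∃ w : CoprodI.Word (fun _ : Bool => P), Reduced (fun _ : Bool => Q.subtype) w ∧
      w.fstIdx = some i ∧ ofCoprodI w.prod = g := by
  induction hg with
  | single i p hp =>
    have h1 : p ≠ 1 := by rintro rfl; exact hp Q.one_mem
    have hne : (.empty : CoprodI.Word (fun _ : Bool => P)).fstIdx ≠ some i := by
      simp [CoprodI.Word.fstIdx, CoprodI.Word.empty]
    refine ⟨CoprodI.Word.cons (i := i) p .empty hne h1, ?_,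
      by simp [CoprodI.Word.fstIdx, CoprodI.Word.cons], by simp⟩
    intro l hl
    simp only [CoprodI.Word.cons, CoprodI.Word.empty, List.mem_singleton] at hl
    subst hl
    simpa using hp
  | cons i p hp g hg ih =>
    obtain ⟨w, hw, hi, hprod⟩ := ih
    have h1 : p ≠ 1 := by rintro rfl; exact hp Q.one_mem
    refine ⟨CoprodI.Word.cons (i := i) p w (by simp [hi]) h1, ?_,
      by simp [CoprodI.Word.fstIdx, CoprodI.Word.cons], by simp [hprod]⟩
    intro l hl
    simp only [CoprodI.Word.cons, List.mem_cons] at hl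
    rcases hl with rfl | hl
    · simpa using hp
    · exact hw l hl

theorem StartsWith.notMem_range_base {i : Bool} {g : Double Q} (hg : StartsWith i g) :
    g ∉ (base (fun _ : Bool => Q.subtype)).range := by
  intro h
  obtain ⟨w, hw, hi, rfl⟩ := hg.exists_word
  have := hw.eq_empty_of_mem_range (fun _ => Q.subtype_injective) h
  subst this
  simp [CoprodI.Word.fstIdx, CoprodI.Word.empty] at hi

theorem mem_range_base_or_startsWith (g : Double Q) :
    g ∈ (base (fun _ : Bool => Q.subtype)).range ∨ ∃ i, StartsWith i g := by
  suffices H : ∀ x g : Double Q,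
      (g ∈ (base (fun _ : Bool => Q.subtype)).range ∨ ∃ i, StartsWith i g) →
      (x * g ∈ (base (fun _ : Bool => Q.subtype)).range ∨ ∃ i, StartsWith i (x * g)) by
    simpa using H g 1 (Or.inl (one_mem _))
  have hbase : ∀ (q : Q) (g : Double Q),
      (g ∈ (base (fun _ : Bool => Q.subtype)).range ∨ ∃ i, StartsWith i g) →
      (base (fun _ : Bool => Q.subtype) q * g ∈ (base (fun _ : Bool => Q.subtype)).range ∨
        ∃ i, StartsWith i (base (fun _ : Bool => Q.subtype) q * g)) := by
    rintro q g (h | ⟨i, h⟩)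
    · exact Or.inl (mul_mem ⟨q, rfl⟩ h)
    · exact Or.inr ⟨i, h.base_mul q⟩
  intro x
  induction x using PushoutI.induction_on with
  | of i p =>
    intro g hg
    by_cases hp : p ∈ Q
    · rw [of_eq_base_of_mem hp]
      exact hbase _ g hg
    rcases hg with ⟨q, rfl⟩ | ⟨j, hj⟩
    · right
      refine ⟨i, ?_⟩
      rw [← of_apply_eq_base (fun _ : Bool => Q.subtype) i q, ← map_mul]
      exact .single i _ fun h => hp ((Subgroup.mul_mem_cancel_right Q q.2).1 h)
    · by_cases hij : j = !i
      · subst hij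
        exact Or.inr ⟨i, .cons i p hp g hj⟩
      · obtain rfl : j = i := by revert hij; cases i <;> cases j <;> simp
        cases hj with
        | single _ p' hp' =>
          rw [← map_mul]
          by_cases h : p * p' ∈ Q
          · exact Or.inl ⟨⟨_, h⟩, (of_eq_base_of_mem h _).symm⟩
          · exact Or.inr ⟨_, .single _ _ h⟩
        | cons _ p' hp' g hg =>
          rw [← mul_assoc, ← map_mul]
          by_cases h : p * p' ∈ Q
          · rw [of_eq_base_of_mem h]
            exact Or.inr ⟨_, hg.base_mul _⟩
          · exact Or.inr ⟨_, .cons _ _ h g hg⟩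
  | base q => exact hbase q
  | mul x y hx hy =>
    intro g hg
    rw [mul_assoc]
    exact hx _ (hy g hg)

theorem StartsWith.inv_mul {i : Bool} {g : Double Q} (hg : StartsWith i g) :
    ∀ x : Double Q, StartsWith (!i) x → ∃ k, StartsWith k (g⁻¹ * x) := by
  induction hg with
  | single i p hp =>
    intro x hx
    rw [← map_inv]
    exact ⟨i, .cons i _ (by simpa using hp) x hx⟩
  | cons i p hp g hg ih =>
    intro x hx
    rw [mul_inv_rev, mul_assoc, ← map_inv]
    refine ih _ ?_
    rw [Bool.not_not]
    exact .cons i _ (by simpa using hp) x hx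

/-- An endomorphism of a double which interchanges the two factors has all its
fixed points in the amalgamated subgroup. -/
theorem mem_range_base_of_swap_fixed (Φ : Double Q →* Double Q) (ψ : P → P)
    (hψ : ∀ p, ψ p ∈ Q → p ∈ Q)
    (hΦ : ∀ i p, Φ (of i p) = of (!i) (ψ p)) {g : Double Q} (hg : Φ g = g) :
    g ∈ (base (fun _ : Bool => Q.subtype)).range := by
  rcases mem_range_base_or_startsWith g with h | ⟨i, hi⟩
  · exact h
  have hswap : ∀ {i : Bool} {g : Double Q}, StartsWith i g → StartsWith (!i) (Φ g) := by
    intro i g h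
    induction h with
    | single i p hp =>
      rw [hΦ]
      exact .single _ _ fun h => hp (hψ p h)
    | cons i p hp g hg ih =>
      rw [map_mul, hΦ]
      exact .cons _ _ (fun h => hp (hψ p h)) _ ih
  obtain ⟨k, hk⟩ := hi.inv_mul _ (hswap hi)
  rw [hg, inv_mul_cancel] at hk
  exact absurd (one_mem _) hk.notMem_range_base

end Monoid.PushoutI

namespace RAAG

variable {V : Type*} {Δ : SimpleGraph V} {G : Type*} [Group G]

/-- The standard generator of a right-angled Artin group attached to a vertex. -/
def gen (Δ : SimpleGraph V) (v : V) : RAAG Δ := PresentedGroup.of v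

theorem gen_commute {v w : V} (h : Δ.Adj v w) : Commute (gen Δ v) (gen Δ w) := by
  have : PresentedGroup.mk (raagRels Δ) _ = 1 :=
    PresentedGroup.one_of_mem (rels := raagRels Δ) ⟨v, w, h, rfl⟩
  simp only [map_mul, map_inv] at this
  rw [mul_inv_eq_one, mul_inv_eq_iff_eq_mul] at this
  exact this

/-- The universal property of a right-angled Artin group. -/
def lift (f : V → G) (hf : ∀ v w, Δ.Adj v w → Commute (f v) (f w)) : RAAG Δ →* G :=
  PresentedGroup.toGroup (f := f) (by
    rintro _ ⟨v, w, h, rfl⟩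
    simp only [map_mul, map_inv, FreeGroup.lift_apply_of]
    rw [(hf v w h).eq]
    group)

@[simp]
theorem lift_gen (f : V → G) (hf : ∀ v w, Δ.Adj v w → Commute (f v) (f w)) (v : V) :
    lift f hf (gen Δ v) = f v :=
  PresentedGroup.toGroup.of _

theorem hom_ext {φ ψ : RAAG Δ →* G} (h : ∀ v, φ (gen Δ v) = ψ (gen Δ v)) : φ = ψ :=
  PresentedGroup.ext h

/-- The graph obtained from `Δ` by adding a vertex adjacent to exactly the vertices in `N`. -/
def coneOn (Δ : SimpleGraph V) (N : Set V) : SimpleGraph (Option V) where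
  Adj
    | some v, some w => Δ.Adj v w
    | none, some w => w ∈ N
    | some v, none => v ∈ N
    | none, none => False
  symm := ⟨by
    rintro (_ | v) (_ | w) h
    · exact h
    · exact h
    · exact h
    · exact SimpleGraph.Adj.symm (G := Δ) h⟩
  loopless := ⟨by
    rintro (_ | v) h
    · exact h
    · exact Δ.loopless.irrefl v h⟩

variable {N : Set V}

/-- The inclusion of a right-angled Artin group into that of a cone. -/
def incl (Δ : SimpleGraph V) (N : Set V) : RAAG Δ →* RAAG (coneOn Δ N) :=
  lift (fun v => gen _ (some v)) fun v w h => gen_commute (by exact h)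

/-- The retraction killing the cone vertex. -/
def retr (Δ : SimpleGraph V) (N : Set V) : RAAG (coneOn Δ N) →* RAAG Δ :=
  lift (fun v => v.elim 1 (gen Δ)) (by
    rintro (_ | v) (_ | w) h
    · exact Commute.one_left _
    · exact Commute.one_left _
    · exact Commute.one_right _
    · exact gen_commute h)

@[simp]
theorem incl_gen (v : V) : incl Δ N (gen Δ v) = gen _ (some v) := lift_gen _ _ _

@[simp]
theorem retr_none : retr Δ N (gen _ none) = 1 := lift_gen _ _ _

@[simp]
theorem retr_some (v : V) : retr Δ N (gen _ (some v)) = gen Δ v := lift_gen _ _ _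

@[simp]
theorem retr_incl (x : RAAG Δ) : retr Δ N (incl Δ N x) = x := by
  have : (retr Δ N).comp (incl Δ N) = MonoidHom.id _ := hom_ext fun v => by simp
  exact DFunLike.congr_fun this x

/-- The data needed to extend an involution `ψ` over a cone by a transvection involution. -/
structure ConeData (Δ : SimpleGraph V) (N : Set V) (ψ : RAAG Δ →* RAAG Δ) : Prop where
  indep : ∀ v w, v ∉ N → w ∉ N → ¬ Δ.Adj v w
  invol : ∀ x, ψ (ψ x) = x
  map_mem : ∀ v ∈ N, ψ (gen Δ v) ∈ Subgroup.closure (gen Δ '' N)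
  map_eq : ∀ v, v ∉ N → ψ (gen Δ v) = gen Δ v

variable {ψ : RAAG Δ →* RAAG Δ}

theorem commute_incl_of_mem_closure {x : RAAG Δ} (hx : x ∈ Subgroup.closure (gen Δ '' N)) :
    Commute (gen (coneOn Δ N) none) (incl Δ N x) := by
  induction hx using Subgroup.closure_induction with
  | mem x hx =>
    obtain ⟨v, hv, rfl⟩ := hx
    rw [incl_gen]
    exact gen_commute hv
  | one => simp
  | mul x y _ _ hx hy => rw [map_mul]; exact hx.mul_right hy
  | inv x _ hx => rw [map_inv]; exact hx.inv_right

open Classical in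
/-- The involution of the cone group that inverts the cone generator `t`, sends each generator
`v` outside `N` to `v * t⁻¹` and agrees with `ψ` on the generators in `N`. -/
noncomputable def coneTwist (h : ConeData Δ N ψ) : RAAG (coneOn Δ N) →* RAAG (coneOn Δ N) :=
  lift (fun v => v.elim (gen _ none)⁻¹
    fun v => if v ∈ N then incl Δ N (ψ (gen Δ v)) else gen _ (some v) * (gen _ none)⁻¹) (by
    have key : ∀ v w, Δ.Adj v w → v ∈ N → w ∉ N →
        Commute (incl Δ N (ψ (gen Δ v))) (gen _ (some w) * (gen _ none)⁻¹) := by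
      intro v w hvw hv hw
      refine Commute.mul_right ?_ (commute_incl_of_mem_closure (h.map_mem v hv)).symm.inv_right
      rw [← incl_gen, ← h.map_eq w hw]
      exact ((gen_commute hvw).map ψ).map (incl Δ N)
    rintro (_ | v) (_ | w) hvw
    · exact hvw.elim
    · have hw : w ∈ N := hvw
      simp only [Option.elim_none, Option.elim_some, if_pos hw]
      exact (commute_incl_of_mem_closure (h.map_mem w hw)).inv_left
    · have hv : v ∈ N := hvw
      simp only [Option.elim_none, Option.elim_some, if_pos hv]
      exact (commute_incl_of_mem_closure (h.map_mem v hv)).symm.inv_right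
    · replace hvw : Δ.Adj v w := hvw
      simp only [Option.elim_some]
      split_ifs with hv hw hw
      · exact ((gen_commute hvw).map ψ).map (incl Δ N)
      · exact key v w hvw hv hw
      · exact (key w v hvw.symm hw hv).symm
      · exact (h.indep v w hv hw hvw).elim)

section coneTwist

variable (h : ConeData Δ N ψ)

theorem coneTwist_none : coneTwist h (gen _ none) = (gen _ none)⁻¹ := lift_gen _ _ _

theorem coneTwist_of_mem {v : V} (hv : v ∈ N) :
    coneTwist h (gen _ (some v)) = incl Δ N (ψ (gen Δ v)) := by
  simp [coneTwist, hv]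

theorem coneTwist_of_notMem {v : V} (hv : v ∉ N) :
    coneTwist h (gen _ (some v)) = gen _ (some v) * (gen _ none)⁻¹ := by
  simp [coneTwist, hv]

/-- The subgroup of `RAAG Δ` over which the group of the cone splits as a double. -/
def core (Δ : SimpleGraph V) (N : Set V) (v₀ : V) : Subgroup (RAAG Δ) :=
  Subgroup.closure (gen Δ '' N ∪ (fun n => gen Δ v₀ * gen Δ n * (gen Δ v₀)⁻¹) '' N ∪
    (fun v => gen Δ v * (gen Δ v₀)⁻¹) '' Nᶜ)

theorem core_induction {v₀ : V} {p : RAAG Δ → Prop} (one : p 1) (mul : ∀ x y, p x → p y → p (x * y))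
    (inv : ∀ x, p x → p x⁻¹) (gen_mem : ∀ n ∈ N, p (gen Δ n))
    (conj_mem : ∀ n ∈ N, p (gen Δ v₀ * gen Δ n * (gen Δ v₀)⁻¹))
    (div_mem : ∀ v, v ∉ N → p (gen Δ v * (gen Δ v₀)⁻¹)) {x : RAAG Δ} (hx : x ∈ core Δ N v₀) :
    p x := by
  induction hx using Subgroup.closure_induction with
  | mem x hx =>
    rcases hx with (⟨n, hn, rfl⟩ | ⟨n, hn, rfl⟩) | ⟨v, hv, rfl⟩
    · exact gen_mem n hn
    · exact conj_mem n hn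
    · exact div_mem v hv
  | one => exact one
  | mul x y _ _ hx hy => exact mul x y hx hy
  | inv x _ hx => exact inv x hx

theorem closure_le_core {v₀ : V} : Subgroup.closure (gen Δ '' N) ≤ core Δ N v₀ :=
  Subgroup.closure_mono fun _ hx => Or.inl (Or.inl hx)

theorem conj_mem_core {v₀ : V} {x : RAAG Δ} (hx : x ∈ Subgroup.closure (gen Δ '' N)) :
    gen Δ v₀ * x * (gen Δ v₀)⁻¹ ∈ core Δ N v₀ := by
  induction hx using Subgroup.closure_induction with
  | mem x hx =>
    obtain ⟨n, hn, rfl⟩ := hx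
    exact Subgroup.subset_closure (Or.inl (Or.inr ⟨n, hn, rfl⟩))
  | one => simp [one_mem]
  | mul x y _ _ hx hy => simpa [mul_assoc] using mul_mem hx hy
  | inv x _ hx => simpa [mul_assoc] using inv_mem hx

theorem div_mem_core {v₀ v : V} (hv : v ∉ N) : gen Δ v * (gen Δ v₀)⁻¹ ∈ core Δ N v₀ :=
  Subgroup.subset_closure (Or.inr ⟨v, hv, rfl⟩)

theorem map_mem_core (h : ConeData Δ N ψ) {v₀ : V} (hv₀ : v₀ ∉ N) {x : RAAG Δ}
    (hx : x ∈ core Δ N v₀) :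
    ψ x ∈ core Δ N v₀ := by
  refine core_induction (p := fun x => ψ x ∈ core Δ N v₀) ?_ (fun x y hx hy => ?_)
    (fun x hx => ?_) (fun n hn => ?_) (fun n hn => ?_) (fun v hv => ?_) hx
  · simp [one_mem]
  · rw [map_mul]; exact mul_mem hx hy
  · rw [map_inv]; exact inv_mem hx
  · exact closure_le_core (h.map_mem n hn)
  · rw [map_mul, map_mul, map_inv, h.map_eq _ hv₀]
    exact conj_mem_core (h.map_mem n hn)
  · rw [map_mul, map_inv, h.map_eq _ hv₀, h.map_eq _ hv]
    exact div_mem_core hv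

theorem coneTwist_incl_of_mem_core {v₀ : V} (hv₀ : v₀ ∉ N) {x : RAAG Δ} (hx : x ∈ core Δ N v₀) :
    coneTwist h (incl Δ N x) = incl Δ N (ψ x) := by
  refine core_induction (p := fun x => coneTwist h (incl Δ N x) = incl Δ N (ψ x)) ?_
    (fun x y hx hy => ?_) (fun x hx => ?_) (fun n hn => ?_) (fun n hn => ?_) (fun v hv => ?_) hx
  · simp
  · simp only [map_mul, hx, hy]
  · simp only [map_inv, hx]
  · rw [incl_gen, coneTwist_of_mem h hn]
  · have := commute_incl_of_mem_closure (h.map_mem n hn)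
    simp only [map_mul, map_inv, incl_gen, coneTwist_of_mem h hn, coneTwist_of_notMem h hv₀,
      h.map_eq _ hv₀, mul_inv_rev, inv_inv]
    rw [mul_assoc (gen _ (some v₀)), this.inv_left.eq]
    group
  · simp [coneTwist_of_notMem h hv₀, coneTwist_of_notMem h hv, h.map_eq _ hv₀, h.map_eq _ hv]

theorem coneTwist_incl_of_mem_closure {x : RAAG Δ} (hx : x ∈ Subgroup.closure (gen Δ '' N)) :
    coneTwist h (incl Δ N x) = incl Δ N (ψ x) := by
  induction hx using Subgroup.closure_induction with
  | mem x hx =>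
    obtain ⟨n, hn, rfl⟩ := hx
    rw [incl_gen, coneTwist_of_mem h hn]
  | one => simp
  | mul x y _ _ hx hy => simp only [map_mul, hx, hy]
  | inv x _ hx => simp only [map_inv, hx]

theorem coneTwist_coneTwist (x : RAAG (coneOn Δ N)) : coneTwist h (coneTwist h x) = x := by
  have : (coneTwist h).comp (coneTwist h) = MonoidHom.id _ := by
    refine hom_ext ?_
    rintro (_ | v)
    · simp [coneTwist_none h]
    · by_cases hv : v ∈ N
      · simp [coneTwist_of_mem h hv, coneTwist_incl_of_mem_closure h (h.map_mem v hv), h.invol]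
      · simp [coneTwist_of_notMem h hv, coneTwist_none h]
  exact DFunLike.congr_fun this x

open Monoid PushoutI

theorem of_eq_of_of_mem_core {v₀ : V} {x : RAAG Δ} (hx : x ∈ core Δ N v₀) (i j : Bool) :
    (of i x : Double (core Δ N v₀)) = of j x := by
  rw [of_eq_base_of_mem hx, of_eq_base_of_mem hx]

/-- The map from the group of a cone to a double of the group of the base. -/
def toDouble (Δ : SimpleGraph V) (N : Set V) (v₀ : V) :
    RAAG (coneOn Δ N) →* Double (core Δ N v₀) :=
  lift (fun v => v.elim ((of true (gen Δ v₀))⁻¹ * of false (gen Δ v₀))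
    fun v => of false (gen Δ v)) (by
    have key : ∀ n ∈ N, Commute ((of true (gen Δ v₀))⁻¹ * of false (gen Δ v₀))
        (of false (gen Δ n) : Double (core Δ N v₀)) := by
      intro n hn
      have hn' := Subgroup.subset_closure (Set.mem_image_of_mem (gen Δ) hn)
      have h1 := of_eq_of_of_mem_core (closure_le_core (v₀ := v₀) hn') false true
      have h2 := of_eq_of_of_mem_core (conj_mem_core (v₀ := v₀) hn') false true
      simp only [map_mul, map_inv] at h2
      rw [mul_inv_eq_iff_eq_mul] at h2
      rw [commute_iff_eq, mul_assoc, h2, h1]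
      group
    rintro (_ | v) (_ | w) hvw
    · exact hvw.elim
    · exact key w hvw
    · exact (key v hvw).symm
    · exact (gen_commute (Δ := Δ) hvw).map
        (of (φ := fun _ : Bool => (core Δ N v₀).subtype) false))

theorem toDouble_incl {v₀ : V} (x : RAAG Δ) : toDouble Δ N v₀ (incl Δ N x) = of false x := by
  have : (toDouble Δ N v₀).comp (incl Δ N) =
      of (φ := fun _ : Bool => (core Δ N v₀).subtype) false := hom_ext fun v => by simp [toDouble]
  exact DFunLike.congr_fun this x

/-- A point fixed by `coneTwist` comes from a fixed point of `ψ` in the core. -/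
theorem exists_mem_core_of_coneTwist_eq {v₀ : V} (hv₀ : v₀ ∉ N) {x : RAAG (coneOn Δ N)}
    (hx : coneTwist h x = x) : ∃ q ∈ core Δ N v₀, incl Δ N q = x ∧ ψ q = q := by
  let back : Double (core Δ N v₀) →* RAAG (coneOn Δ N) :=
    PushoutI.lift (fun i => cond i ((coneTwist h).comp ((incl Δ N).comp ψ)) (incl Δ N))
      ((incl Δ N).comp (core Δ N v₀).subtype) (by
      rintro (_ | _)
      · rfl
      · ext q
        simp [coneTwist_incl_of_mem_core h hv₀ (map_mem_core h hv₀ q.2), h.invol])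
  let swap : Double (core Δ N v₀) →* Double (core Δ N v₀) :=
    PushoutI.lift (fun i => (of (!i)).comp ψ)
      ((of false).comp (ψ.comp (core Δ N v₀).subtype)) (by
      intro i
      ext q
      exact of_eq_of_of_mem_core (map_mem_core h hv₀ q.2) _ _)
  have hback : back.comp (toDouble Δ N v₀) = MonoidHom.id _ := by
    refine hom_ext ?_
    rintro (_ | v)
    · simp [back, toDouble, h.map_eq _ hv₀, coneTwist_of_notMem h hv₀]
    · simp [back, toDouble]
  have hswap : swap.comp (toDouble Δ N v₀) = (toDouble Δ N v₀).comp (coneTwist h) := by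
    refine hom_ext ?_
    rintro (_ | v)
    · simp [swap, toDouble, h.map_eq _ hv₀, coneTwist_none h]
    · by_cases hv : v ∈ N
      · simp only [MonoidHom.comp_apply, coneTwist_of_mem h hv, toDouble_incl]
        rw [← of_eq_of_of_mem_core (closure_le_core (h.map_mem v hv)) true false]
        simp [swap, toDouble]
      · have := of_eq_of_of_mem_core (div_mem_core (Δ := Δ) (v₀ := v₀) hv) true false
        simp only [map_mul, map_inv] at this
        rw [mul_inv_eq_iff_eq_mul] at this
        simp [swap, toDouble, h.map_eq _ hv, coneTwist_of_notMem h hv, this,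
          mul_assoc]
  have hfix : swap (toDouble Δ N v₀ x) = toDouble Δ N v₀ x := by
    rw [← MonoidHom.comp_apply, hswap, MonoidHom.comp_apply, hx]
  obtain ⟨q, hq⟩ := mem_range_base_of_swap_fixed swap ψ
    (fun p hp => by simpa [h.invol] using map_mem_core h hv₀ hp) (fun i p => by simp [swap]) hfix
  have hqx : incl Δ N q = x := by
    have := DFunLike.congr_fun hback x
    rw [MonoidHom.comp_apply, ← hq] at this
    simpa [back] using this
  refine ⟨q, q.2, hqx, ?_⟩
  rw [← hqx, coneTwist_incl_of_mem_core h hv₀ q.2] at hx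
  simpa using congrArg (retr Δ N) hx

end coneTwist

/-- The bipartite graph in which `inl i` is adjacent to `inr i` and `inr (i + 1)`, cyclically. -/
def cycle (g : ℕ) : SimpleGraph (Fin (g + 1) ⊕ Fin (g + 1)) where
  Adj
    | .inl i, .inr j => j = i ∨ j = i + 1
    | .inr j, .inl i => j = i ∨ j = i + 1
    | _, _ => False
  symm := ⟨by rintro (i | i) (j | j) h <;> exact h⟩
  loopless := ⟨by rintro (i | i) h <;> exact h⟩

section Action

variable {g : ℕ}

/-- The universal property of the group of `cycle g`. -/
def liftCycle (f₁ f₂ : Fin (g + 1) → G)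
    (hf : ∀ i j, j = i ∨ j = i + 1 → Commute (f₁ i) (f₂ j)) : RAAG (cycle g) →* G :=
  lift (Sum.elim f₁ f₂) (by
    rintro (i | i) (j | j) h
    · exact h.elim
    · exact hf i j h
    · exact (hf j i h).symm
    · exact h.elim)

@[simp]
theorem liftCycle_inl (f₁ f₂ : Fin (g + 1) → G)
    (hf : ∀ i j, j = i ∨ j = i + 1 → Commute (f₁ i) (f₂ j)) (i : Fin (g + 1)) :
    liftCycle f₁ f₂ hf (gen _ (.inl i)) = f₁ i := lift_gen _ _ _

@[simp]
theorem liftCycle_inr (f₁ f₂ : Fin (g + 1) → G)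
    (hf : ∀ i j, j = i ∨ j = i + 1 → Commute (f₁ i) (f₂ j)) (i : Fin (g + 1)) :
    liftCycle f₁ f₂ hf (gen _ (.inr i)) = f₂ i := lift_gen _ _ _

/-- The involution crossing a horizontal edge of a square of groups with label `X`. -/
def flipFst (X : Bool → G) : Equiv.Perm (Bool × Bool × G) :=
  Function.Involutive.toPerm
    (fun z => (!z.1, z.2.1, cond z.1 (X z.2.1) (X z.2.1)⁻¹ * z.2.2)) (by
      rintro ⟨_ | _, v, z⟩ <;> simp)

/-- The involution crossing a vertical edge of a square of groups with label `Y`. -/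
def flipSnd (Y : Bool → G) : Equiv.Perm (Bool × Bool × G) :=
  Function.Involutive.toPerm
    (fun z => (z.1, !z.2.1, cond z.2.1 (Y z.1) (Y z.1)⁻¹ * z.2.2)) (by
      rintro ⟨v, _ | _, z⟩ <;> simp)

theorem flipFst_apply (X : Bool → G) (v w : Bool) (z : G) :
    flipFst X (v, w, z) = (!v, w, cond v (X w) (X w)⁻¹ * z) := rfl

theorem flipSnd_apply (Y : Bool → G) (v w : Bool) (z : G) :
    flipSnd Y (v, w, z) = (v, !w, cond w (Y v) (Y v)⁻¹ * z) := rfl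

theorem flipFst_symm (X : Bool → G) : (flipFst X).symm = flipFst X :=
  Function.Involutive.toPerm_symm _

theorem flipSnd_symm (Y : Bool → G) : (flipSnd Y).symm = flipSnd Y :=
  Function.Involutive.toPerm_symm _

theorem commute_flip {X Y : Bool → G} (h : X false * Y true = Y false * X true) :
    Commute (flipFst X) (flipSnd Y) := by
  have h₀ : X true = (Y false)⁻¹ * X false * Y true := by rw [mul_assoc, h]; group
  refine Equiv.ext ?_
  rintro ⟨_ | _, _ | _, z⟩ <;> simp [flipFst_apply, flipSnd_apply, h₀, mul_assoc]

/-- The labels of the edges satisfy the square relations. -/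
def Labels (X Y : Fin (g + 1) → Bool → G) : Prop :=
  ∀ i j, j = i ∨ j = i + 1 → X i false * Y j true = Y j false * X i true

/-- The action of the group of `cycle g` determined by labels. -/
def act {X Y : Fin (g + 1) → Bool → G} (h : Labels X Y) :
    RAAG (cycle g) →* Equiv.Perm (Bool × Bool × G) :=
  liftCycle (fun i => flipFst (X i)) (fun j => flipSnd (Y j)) fun i j hij =>
    commute_flip (h i j hij)

theorem act_inl {X Y : Fin (g + 1) → Bool → G} (h : Labels X Y) (i : Fin (g + 1)) :
    act h (gen _ (.inl i)) = flipFst (X i) := liftCycle_inl _ _ _ _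

theorem act_inr {X Y : Fin (g + 1) → Bool → G} (h : Labels X Y) (j : Fin (g + 1)) :
    act h (gen _ (.inr j)) = flipSnd (Y j) := liftCycle_inr _ _ _ _

/-- Two labelled actions are intertwined by a twisted homomorphism. -/
theorem act_intertwine {H : Type*} [Group H] {X Y : Fin (g + 1) → Bool → G} (h : Labels X Y)
    {X' Y' : Fin (g + 1) → Bool → H} (h' : Labels X' Y') (σ : G →* H) (T : Bool → Bool → H)
    (hX : ∀ i v, σ (X i v) = T false v * X' i v * (T true v)⁻¹)
    (hY : ∀ j v, σ (Y j v) = T v false * Y' j v * (T v true)⁻¹)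
    (x : RAAG (cycle g)) (z : Bool × Bool × G) :
    act h' x (z.1, z.2.1, (T z.1 z.2.1)⁻¹ * σ z.2.2) =
      ((act h x z).1, (act h x z).2.1,
        (T (act h x z).1 (act h x z).2.1)⁻¹ * σ (act h x z).2.2) := by
  have hmem : x ∈ Subgroup.closure (Set.range (gen (cycle g))) := by
    have : Subgroup.closure (Set.range (gen (cycle g))) = ⊤ :=
      PresentedGroup.closure_range_of _
    rw [this]
    trivial
  have hgen : ∀ (v : Fin (g + 1) ⊕ Fin (g + 1)) (z : Bool × Bool × G),
      act h' (gen _ v) (z.1, z.2.1, (T z.1 z.2.1)⁻¹ * σ z.2.2) =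
      ((act h (gen _ v) z).1, (act h (gen _ v) z).2.1,
        (T (act h (gen _ v) z).1 (act h (gen _ v) z).2.1)⁻¹ * σ (act h (gen _ v) z).2.2) := by
    rintro (i | i) ⟨_ | _, _ | _, z⟩ <;>
      simp [act_inl, act_inr, flipFst_apply, flipSnd_apply, hX, hY, mul_assoc]
  induction hmem using Subgroup.closure_induction generalizing z with
  | mem x hx => obtain ⟨v, rfl⟩ := hx; exact hgen v z
  | one => simp
  | mul x y _ _ hx hy => rw [map_mul, Equiv.Perm.mul_apply, hy, hx, map_mul]; rfl
  | inv x _ hx =>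
    rw [map_inv, map_inv, Equiv.Perm.inv_eq_iff_eq, hx]
    simp

/-- The involutions of the half-twisted regular representation. -/
def flipHalf (y : G) : Equiv.Perm (Bool × G) :=
  Function.Involutive.toPerm (fun z => (!z.1, cond z.1 y y⁻¹ * z.2)) (by
    rintro ⟨_ | _, z⟩ <;> simp)

theorem flipHalf_apply (y : G) (v : Bool) (z : G) :
    flipHalf y (v, z) = (!v, cond v y y⁻¹ * z) := rfl

theorem flipHalf_symm (y : G) : (flipHalf y).symm = flipHalf y :=
  Function.Involutive.toPerm_symm _

/-- Left multiplication on the second component. -/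
def mulSnd (x : G) : Equiv.Perm (Bool × G) := Equiv.prodCongr (Equiv.refl _) (Equiv.mulLeft x)

theorem mulSnd_apply (x : G) (v : Bool) (z : G) : mulSnd x (v, z) = (v, x * z) := rfl

theorem mulSnd_symm (x : G) : (mulSnd x).symm = mulSnd x⁻¹ :=
  Equiv.ext fun _ => rfl

theorem gen_inl_commute {i j : Fin (g + 1)} (h : j = i ∨ j = i + 1) :
    Commute (gen (cycle g) (.inl i)) (gen (cycle g) (.inr j)) :=
  gen_commute (by exact h)

/-- The action of the group of `cycle g` in which only the generators `inr j` are twisted. -/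
def actHalf (g : ℕ) : RAAG (cycle g) →* Equiv.Perm (Bool × RAAG (cycle g)) :=
  liftCycle (fun i => mulSnd (gen _ (.inl i))) (fun j => flipHalf (gen _ (.inr j)))
    fun i j hij => by
      have := gen_inl_commute hij
      refine Equiv.ext ?_
      rintro ⟨_ | _, z⟩
      · simp [mulSnd_apply, flipHalf_apply, ← mul_assoc, this.inv_right.eq]
      · simp [mulSnd_apply, flipHalf_apply, ← mul_assoc, this.eq]

theorem actHalf_inl (i : Fin (g + 1)) :
    actHalf g (gen _ (.inl i)) = mulSnd (gen _ (.inl i)) := liftCycle_inl _ _ _ _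

theorem actHalf_inr (j : Fin (g + 1)) :
    actHalf g (gen _ (.inr j)) = flipHalf (gen _ (.inr j)) := liftCycle_inr _ _ _ _

theorem labels_gen (g : ℕ) : Labels (fun i _ => gen (cycle g) (.inl i))
    (fun j _ => gen (cycle g) (.inr j)) :=
  fun _ _ h => gen_inl_commute h

theorem actHalf_of_mem_core {k : RAAG (cycle g)} (hk : k ∈ core (cycle g) (Set.range .inl) (.inr 0))
    (z : RAAG (cycle g)) : actHalf g k (false, z) = (false, k * z) := by
  revert z
  refine core_induction (p := fun k => ∀ z, actHalf g k (false, z) = (false, k * z)) ?_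
    (fun x y hx hy z => ?_) (fun x hx z => ?_) ?_ ?_ ?_ hk
  · simp
  · rw [map_mul, Equiv.Perm.mul_apply, hy, hx, mul_assoc]
  · rw [map_inv, Equiv.Perm.inv_eq_iff_eq, hx, mul_inv_cancel_left]
  · rintro _ ⟨i, rfl⟩ z
    simp [actHalf_inl, mulSnd_apply]
  · rintro _ ⟨i, rfl⟩ z
    simp [actHalf_inl, actHalf_inr, mulSnd_apply, flipHalf_symm, flipHalf_apply, mul_assoc]
  · rintro (i | j) hj z
    · simp at hj
    · simp [actHalf_inr, flipHalf_symm, flipHalf_apply, mul_assoc]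

end Action

section Involution

variable (g : ℕ)

theorem coneData_base : ConeData (cycle g) (Set.range .inl) (MonoidHom.id _) where
  indep := by
    rintro (i | i) (j | j) hi hj h
    · exact h
    · exact hi ⟨i, rfl⟩
    · exact hj ⟨j, rfl⟩
    · exact h
  invol _ := rfl
  map_mem v hv := Subgroup.subset_closure ⟨v, hv, rfl⟩
  map_eq _ _ := rfl

/-- The group of `cycle g` extended by one vertex, adjacent to all vertices `inl i`. -/
abbrev coned : SimpleGraph (Option (Fin (g + 1) ⊕ Fin (g + 1))) :=
  coneOn (cycle g) (Set.range .inl)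

/-- The vertices of `coned g` other than the `inl i`. -/
def twistSet : Set (Option (Fin (g + 1) ⊕ Fin (g + 1))) := {v | ∀ i, v ≠ some (.inl i)}

variable {g}

theorem none_mem_twistSet : none ∈ twistSet g := fun _ h => nomatch h

theorem inr_mem_twistSet (j : Fin (g + 1)) : some (.inr j) ∈ twistSet g := fun _ h => nomatch h

theorem inl_notMem_twistSet (i : Fin (g + 1)) : some (.inl i) ∉ twistSet g := fun h => h i rfl

theorem exists_of_notMem_twistSet {v : Option (Fin (g + 1) ⊕ Fin (g + 1))} (hv : v ∉ twistSet g) :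
    ∃ i, v = some (.inl i) := by
  simpa [twistSet] using hv

variable (g)

theorem coneData_coned : ConeData (coned g) (twistSet g) (coneTwist (coneData_base g)) where
  indep v w hv hw h := by
    obtain ⟨i, rfl⟩ := exists_of_notMem_twistSet hv
    obtain ⟨j, rfl⟩ := exists_of_notMem_twistSet hw
    exact h
  invol := coneTwist_coneTwist _
  map_mem v hv := by
    have hn : gen (coned g) none ∈ Subgroup.closure (gen (coned g) '' twistSet g) :=
      Subgroup.subset_closure ⟨_, none_mem_twistSet, rfl⟩
    rcases v with _ | i | j
    · rw [coneTwist_none]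
      exact inv_mem hn
    · exact (inl_notMem_twistSet i hv).elim
    · rw [coneTwist_of_notMem _ (by simp)]
      exact mul_mem (Subgroup.subset_closure ⟨_, hv, rfl⟩) (inv_mem hn)
  map_eq v hv := by
    obtain ⟨i, rfl⟩ := exists_of_notMem_twistSet hv
    exact (coneTwist_of_mem (coneData_base g) ⟨i, rfl⟩).trans (incl_gen _)

/-- The inclusion of the group of `cycle g` into the group of its double cone. -/
def inclTwo : RAAG (cycle g) →* RAAG (coneOn (coned g) (twistSet g)) :=
  (incl (coned g) (twistSet g)).comp (incl (cycle g) (Set.range .inl))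

/-- The involution of the group of the double cone. -/
noncomputable def twist :
    RAAG (coneOn (coned g) (twistSet g)) →* RAAG (coneOn (coned g) (twistSet g)) :=
  coneTwist (coneData_coned g)

variable {g}

theorem inclTwo_injective : Function.Injective (inclTwo g) :=
  (Function.LeftInverse.injective (g := retr _ _) retr_incl).comp
    (Function.LeftInverse.injective (g := retr _ _) retr_incl)

theorem twist_inclTwo_inl (i : Fin (g + 1)) : twist g (inclTwo g (gen _ (.inl i))) =
    inclTwo g (gen _ (.inl i)) * (gen _ none)⁻¹ := by
  simp [twist, inclTwo, coneTwist_of_notMem _ (inl_notMem_twistSet i)]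

theorem twist_inclTwo_inr (j : Fin (g + 1)) : twist g (inclTwo g (gen _ (.inr j))) =
    inclTwo g (gen _ (.inr j)) * (gen _ (some none))⁻¹ := by
  simp [twist, inclTwo, coneTwist_of_mem _ (inr_mem_twistSet j), coneTwist_of_notMem]

theorem act_of_mem_core {q : RAAG (coned g)}
    (hq : q ∈ core (coned g) (twistSet g) (some (.inl 0))) (z : Bool × RAAG (cycle g)) :
    act (labels_gen g) (retr _ _ q) (false, z) = (false, actHalf g (retr _ _ q) z) := by
  revert z
  refine core_induction (p := fun q => ∀ z, act (labels_gen g) (retr _ _ q) (false, z) =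
    (false, actHalf g (retr _ _ q) z)) ?_
    (fun x y hx hy z => ?_) (fun x hx z => ?_) (fun n hn => ?_) (fun n hn => ?_) ?_ hq
  · simp
  · simp only [map_mul, Equiv.Perm.mul_apply, hy, hx]
  · simp only [map_inv]
    rw [Equiv.Perm.inv_eq_iff_eq, hx]
    simp
  · rcases n with _ | i | j
    · simp
    · exact (inl_notMem_twistSet i hn).elim
    · rintro ⟨v, z⟩
      simp [act_inr, actHalf_inr, flipSnd_apply, flipHalf_apply]
  · rcases n with _ | i | j
    · simp
    · exact (inl_notMem_twistSet i hn).elim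
    · rintro ⟨v, z⟩
      simp [act_inr, actHalf_inr, flipSnd_apply, flipHalf_apply, act_inl, actHalf_inl,
        flipFst_symm, flipFst_apply, mulSnd_symm, mulSnd_apply]
  · rintro v hv ⟨w, z⟩
    obtain ⟨i, rfl⟩ := exists_of_notMem_twistSet hv
    simp [act_inl, actHalf_inl, flipFst_symm, flipFst_apply, mulSnd_symm, mulSnd_apply]

theorem exists_of_twist_eq {x : RAAG (coneOn (coned g) (twistSet g))} (hx : twist g x = x) :
    ∃ k, inclTwo g k = x ∧ act (labels_gen g) k (false, false, 1) = (false, false, k) := by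
  obtain ⟨q, hq, rfl, hq'⟩ :=
    exists_mem_core_of_coneTwist_eq (coneData_coned g) (inl_notMem_twistSet 0) hx
  obtain ⟨k, hk, rfl, -⟩ :=
    exists_mem_core_of_coneTwist_eq (coneData_base g) (v₀ := .inr 0) (by simp) hq'
  refine ⟨k, rfl, ?_⟩
  have := act_of_mem_core hq (false, 1)
  rwa [retr_incl, actHalf_of_mem_core hk, mul_one] at this

end Involution

section Surface

/-- The product `b (k - 1) * ⋯ * b 0`. -/
def descProd (b : ℕ → G) : ℕ → G
  | 0 => 1
  | k + 1 => b k * descProd b k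

/-- The product of the first `k` commutators of `a` and `b`. -/
def commProd (a b : ℕ → G) : ℕ → G
  | 0 => 1
  | k + 1 => commProd a b k * (a k * b k * (a k)⁻¹ * (b k)⁻¹)

theorem prod_finRange_eq_commProd (a b : ℕ → G) (n : ℕ) :
    ((List.finRange n).map fun i : Fin n => a i * b i * (a i)⁻¹ * (b i)⁻¹).prod =
      commProd a b n := by
  induction n with
  | zero => simp [commProd]
  | succ n ih =>
    rw [List.finRange_succ_last, List.map_append, List.prod_append, List.map_map]
    simp only [Function.comp_def, Fin.val_castSucc, ih]
    simp [commProd]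

/-- Labels for the horizontal edges. -/
def labelX (a b : ℕ → G) (k : ℕ) (v : Bool) : G :=
  cond v ((a k)⁻¹ * (commProd a b k)⁻¹) ((descProd b k)⁻¹ * (a k)⁻¹ * descProd b k)

/-- Labels for the vertical edges. -/
def labelY (a b : ℕ → G) (k : ℕ) (v : Bool) : G :=
  (descProd b k)⁻¹ * cond v (commProd a b k)⁻¹ 1

theorem labels_of_commProd_eq_one {g : ℕ} {a b : ℕ → G} (ha : a g = 1)
    (hC : commProd a b g = 1) :
    Labels (g := g) (fun i => labelX a b i) (fun j => labelY a b j) := by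
  rintro i j (rfl | rfl)
  · simp [labelX, labelY, mul_assoc]
  · rcases eq_or_ne i (Fin.last g) with rfl | hi
    · simp [labelX, labelY, ha, hC, descProd, commProd]
    · have hi' : ((i + 1 : Fin (g + 1)) : ℕ) = i + 1 := by
        rw [Fin.val_add_one, if_neg hi]
      simp only [labelX, labelY, hi', descProd, commProd, cond_true, cond_false]
      group

variable (g : ℕ)

/-- The generators `a k` of the surface group, extended by `1`. -/
def surfaceA (k : ℕ) : SurfaceGroup g :=
  if h : k < g then PresentedGroup.of (.inl ⟨k, h⟩) else 1

/-- The generators `b k` of the surface group, extended by `1`. -/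
def surfaceB (k : ℕ) : SurfaceGroup g :=
  if h : k < g then PresentedGroup.of (.inr ⟨k, h⟩) else 1

theorem surfaceA_self : surfaceA g g = 1 := dif_neg (lt_irrefl g)

theorem commProd_surface : commProd (surfaceA g) (surfaceB g) g = 1 := by
  have : PresentedGroup.mk {surfaceRel g} (surfaceRel g) = 1 :=
    PresentedGroup.one_of_mem (Set.mem_singleton _)
  rw [← prod_finRange_eq_commProd, ← this]
  refine Eq.trans ?_ (map_list_prod _ _).symm
  rw [List.map_map]
  congr 2
  funext i
  simp only [surfaceA, surfaceB, i.2, dif_pos, Function.comp_apply, map_mul, map_inv]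
  rfl

theorem surfaceLabels : Labels (g := g) (fun i => labelX (surfaceA g) (surfaceB g) i)
    (fun j => labelY (surfaceA g) (surfaceB g) j) :=
  labels_of_commProd_eq_one (surfaceA_self g) (commProd_surface g)

variable {g}

/-- The generator `inl k`, for `k` modulo `g + 1`. -/
def genL (g k : ℕ) : RAAG (cycle g) := gen _ (.inl (Fin.ofNat (g + 1) k))

/-- The generator `inr k`, for `k` modulo `g + 1`. -/
def genR (g k : ℕ) : RAAG (cycle g) := gen _ (.inr (Fin.ofNat (g + 1) k))

theorem genL_genR_commute (k : ℕ) : Commute (genL g k) (genR g k) :=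
  gen_inl_commute (Or.inl rfl)

theorem genL_genR_succ_commute (k : ℕ) : Commute (genL g k) (genR g (k + 1)) :=
  gen_inl_commute (Or.inr (Fin.ext (by simp [Fin.val_add])))

theorem genL_genR_zero_commute : Commute (genL g g) (genR g 0) :=
  gen_inl_commute (Or.inr (Fin.ext (by simp)))

variable (g)

/-- The image of `a k` in the group of `cycle g`. -/
def imageA (k : ℕ) : RAAG (cycle g) :=
  genR g 0 * (genR g k)⁻¹ * genL g g * (genL g k)⁻¹ * genR g k * (genR g 0)⁻¹

/-- The image of `b k` in the group of `cycle g`. -/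
def imageB (k : ℕ) : RAAG (cycle g) :=
  genR g 0 * (genR g (k + 1))⁻¹ * genR g k * (genR g 0)⁻¹

theorem descProd_imageB (k : ℕ) : descProd (imageB g) k = genR g 0 * (genR g k)⁻¹ := by
  induction k with
  | zero => simp [descProd]
  | succ k ih => simp [descProd, ih, imageB, mul_assoc]

theorem commProd_image (k : ℕ) : commProd (imageA g) (imageB g) k =
    genL g g * genR g 0 * (genR g k)⁻¹ * (genL g g)⁻¹ * genR g k * (genR g 0)⁻¹ := by
  induction k with
  | zero => simp [commProd]
  | succ k ih =>
    have h₁ : (genR g k)⁻¹ * (genL g k)⁻¹ * genR g k = (genL g k)⁻¹ := by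
      rw [(genL_genR_commute k).symm.inv_inv.eq, inv_mul_cancel_right]
    have h₂ : (genL g k)⁻¹ * (genR g (k + 1))⁻¹ * genL g k = (genR g (k + 1))⁻¹ := by
      rw [(genL_genR_succ_commute k).inv_inv.eq, inv_mul_cancel_right]
    calc commProd (imageA g) (imageB g) (k + 1)
        = genL g g * genR g 0 * ((genR g k)⁻¹ * (genL g k)⁻¹ * genR g k) * (genR g (k + 1))⁻¹ *
            genL g k * (genL g g)⁻¹ * genR g (k + 1) * (genR g 0)⁻¹ := by
          rw [commProd, ih, imageA, imageB]
          group
      _ = genL g g * genR g 0 * ((genL g k)⁻¹ * (genR g (k + 1))⁻¹ * genL g k) *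
            (genL g g)⁻¹ * genR g (k + 1) * (genR g 0)⁻¹ := by
          rw [h₁]
          group
      _ = _ := by rw [h₂]

theorem commProd_image_self : commProd (imageA g) (imageB g) g = 1 := by
  rw [commProd_image, mul_assoc _ (genR g 0), mul_assoc _ (genR g 0 * _),
    (genL_genR_zero_commute.mul_right (genL_genR_commute g).inv_right).inv_left.symm.eq]
  group

/-- The embedding of the surface group in the group of `cycle g`. -/
def embed : SurfaceGroup g →* RAAG (cycle g) :=
  PresentedGroup.toGroup (f := Sum.elim (fun k : Fin g => imageA g k)
    (fun k : Fin g => imageB g k)) (by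
    rintro _ rfl
    rw [surfaceRel, map_list_prod, List.map_map, ← commProd_image_self,
      ← prod_finRange_eq_commProd]
    simp [Function.comp_def])

theorem embed_inl (k : Fin g) : embed g (PresentedGroup.of (.inl k)) = imageA g k :=
  PresentedGroup.toGroup.of _

theorem embed_inr (k : Fin g) : embed g (PresentedGroup.of (.inr k)) = imageB g k :=
  PresentedGroup.toGroup.of _

variable {g}

theorem embed_surfaceA {k : ℕ} (hk : k ≤ g) : embed g (surfaceA g k) = imageA g k := by
  rcases hk.lt_or_eq with hk | rfl
  · rw [surfaceA, dif_pos hk, embed_inl]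
  · simp [surfaceA_self, imageA]

theorem embed_surfaceB {k : ℕ} (hk : k < g) : embed g (surfaceB g k) = imageB g k := by
  rw [surfaceB, dif_pos hk, embed_inr]

theorem embed_descProd {k : ℕ} (hk : k ≤ g) :
    embed g (descProd (surfaceB g) k) = genR g 0 * (genR g k)⁻¹ := by
  rw [← descProd_imageB]
  induction k with
  | zero => simp [descProd]
  | succ k ih => rw [descProd, map_mul, ih (by lia), embed_surfaceB hk, descProd]

theorem embed_commProd {k : ℕ} (hk : k ≤ g) :
    embed g (commProd (surfaceA g) (surfaceB g) k) =
      genL g g * genR g 0 * (genR g k)⁻¹ * (genL g g)⁻¹ * genR g k * (genR g 0)⁻¹ := by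
  rw [← commProd_image]
  induction k with
  | zero => simp [commProd]
  | succ k ih =>
    simp only [commProd, map_mul, map_inv, ih (by lia : k ≤ g), embed_surfaceB hk,
      embed_surfaceA (by lia : k ≤ g)]

/-- The correction between the two labellings at the corners of a square. -/
def corner (g : ℕ) (v w : Bool) : RAAG (cycle g) := cond v (genL g g) 1 * cond w (genR g 0) 1

theorem genL_val (i : Fin (g + 1)) : genL g i = gen _ (.inl i) := by
  rw [genL, Fin.ofNat_val_eq_self]

theorem genR_val (i : Fin (g + 1)) : genR g i = gen _ (.inr i) := by
  rw [genR, Fin.ofNat_val_eq_self]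

theorem embed_labelX (i : Fin (g + 1)) (v : Bool) :
    embed g (labelX (surfaceA g) (surfaceB g) i v) =
      corner g false v * gen _ (.inl i) * (corner g true v)⁻¹ := by
  have hi : (i : ℕ) ≤ g := Nat.le_of_lt_succ i.2
  rw [← genL_val]
  cases v
  · simp only [labelX, cond_false, map_mul, map_inv, embed_descProd hi, embed_surfaceA hi, imageA,
      corner, cond_true]
    group
  · have h : (genR g i)⁻¹ * genL g i * genR g i = genL g i := by
      rw [mul_assoc, (genL_genR_commute _).eq, inv_mul_cancel_left]
    calc _ = genR g 0 * ((genR g i)⁻¹ * genL g i * genR g i) * (genR g 0)⁻¹ * (genL g g)⁻¹ := by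
          simp only [labelX, cond_true, map_mul, map_inv, embed_commProd hi, embed_surfaceA hi,
            imageA]
          group
      _ = _ := by
          rw [h]
          simp only [corner, cond_true, cond_false]
          group

theorem embed_labelY (j : Fin (g + 1)) (v : Bool) :
    embed g (labelY (surfaceA g) (surfaceB g) j v) =
      corner g v false * gen _ (.inr j) * (corner g v true)⁻¹ := by
  have hj : (j : ℕ) ≤ g := Nat.le_of_lt_succ j.2
  rw [← genR_val]
  cases v <;>
    simp [labelY, map_mul, map_inv, embed_descProd hj, embed_commProd hj, corner, mul_assoc]

theorem embed_eq_of_act_eq {k : RAAG (cycle g)}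
    (hk : act (labels_gen g) k (false, false, 1) = (false, false, k)) :
    ∃ s, embed g s = k := by
  have := act_intertwine (surfaceLabels g) (labels_gen g) (embed g) (corner g) embed_labelX
    embed_labelY k (false, false, 1)
  rcases hs : act (surfaceLabels g) k (false, false, 1) with ⟨v, w, s⟩
  simp only [hs, corner, cond_false, map_one, mul_one, inv_one, hk, Prod.mk.injEq] at this
  obtain ⟨rfl, rfl, h⟩ := this
  exact ⟨s, by simpa using h.symm⟩

theorem act_genL {k : ℕ} (hk : k ≤ g) :
    act (surfaceLabels g) (genL g k) = flipFst (labelX (surfaceA g) (surfaceB g) k) := by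
  rw [genL, act_inl, Fin.val_ofNat, Nat.mod_eq_of_lt (by lia)]

theorem act_genR {k : ℕ} (hk : k ≤ g) :
    act (surfaceLabels g) (genR g k) = flipSnd (labelY (surfaceA g) (surfaceB g) k) := by
  rw [genR, act_inr, Fin.val_ofNat, Nat.mod_eq_of_lt (by lia)]

theorem act_embed (s z : SurfaceGroup g) :
    act (surfaceLabels g) (embed g s) (false, false, z) = (false, false, s * z) := by
  have hs : s ∈ Subgroup.closure (Set.range (PresentedGroup.of (rels := {surfaceRel g}))) := by
    rw [PresentedGroup.closure_range_of]
    trivial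
  induction hs using Subgroup.closure_induction generalizing z with
  | mem s hs =>
    obtain ⟨k | k, rfl⟩ := hs
    · have hA : PresentedGroup.of (.inl k) = surfaceA g k := by simp [surfaceA]
      rw [embed_inl, hA]
      simp [imageA, act_genL k.2.le, act_genR k.2.le, act_genL le_rfl, act_genR (Nat.zero_le g),
        flipFst_symm, flipSnd_symm, flipFst_apply, flipSnd_apply, labelX, labelY, descProd,
        surfaceA_self, mul_assoc]
    · have hB : PresentedGroup.of (.inr k) = surfaceB g k := by simp [surfaceB]
      rw [embed_inr, hB]
      simp [imageB, act_genR k.2.le, act_genR (Nat.succ_le_of_lt k.2), act_genR (Nat.zero_le g),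
        flipSnd_symm, flipSnd_apply, labelY, descProd, mul_assoc]
  | one => simp
  | mul x y _ _ hx hy => rw [map_mul, map_mul, Equiv.Perm.mul_apply, hy, hx, mul_assoc]
  | inv x _ hx => rw [map_inv, map_inv, Equiv.Perm.inv_eq_iff_eq, hx, mul_inv_cancel_left]

theorem embed_injective : Function.Injective (embed g) := by
  intro s s' h
  have := act_embed s 1
  rw [h, act_embed] at this
  simpa using this.symm

theorem twist_embed (s : SurfaceGroup g) :
    twist g (inclTwo g (embed g s)) = inclTwo g (embed g s) := by
  have : (twist g).comp ((inclTwo g).comp (embed g)) = (inclTwo g).comp (embed g) := by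
    refine PresentedGroup.ext ?_
    rintro (k | k)
    · simp [embed_inl, imageA, genL, genR, twist_inclTwo_inl, twist_inclTwo_inr, mul_assoc]
    · simp [embed_inr, imageB, genR, twist_inclTwo_inr, mul_assoc]
  exact DFunLike.congr_fun this s

variable (g)

/-- The involution of the group of the double cone, as an automorphism. -/
noncomputable def twistEquiv :
    RAAG (coneOn (coned g) (twistSet g)) ≃* RAAG (coneOn (coned g) (twistSet g)) :=
  (twist g).toMulEquiv (twist g) (MonoidHom.ext (coneTwist_coneTwist _))
    (MonoidHom.ext (coneTwist_coneTwist _))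

/-- The surface group as the fixed subgroup of `twistEquiv g`. -/
noncomputable def surfaceEquiv : SurfaceGroup g ≃* fixSubgroup (twistEquiv g) :=
  MulEquiv.ofBijective (((inclTwo g).comp (embed g)).codRestrict _ twist_embed) (by
    constructor
    · intro s s' h
      exact embed_injective (inclTwo_injective (congrArg Subtype.val h))
    · rintro ⟨x, hx⟩
      obtain ⟨k, rfl, hk⟩ := exists_of_twist_eq hx
      obtain ⟨s, rfl⟩ := embed_eq_of_act_eq hk
      exact ⟨s, rfl⟩)

end Surface

/-- Isomorphic graphs have isomorphic groups. -/
def congr {W : Type*} {Γ : SimpleGraph W} (e : Δ ≃g Γ) : RAAG Δ ≃* RAAG Γ :=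
  (lift (fun v => gen Γ (e v)) fun _ _ h => gen_commute (e.map_rel_iff.2 h)).toMulEquiv
    (lift (fun v => gen Δ (e.symm v)) fun _ _ h => gen_commute (e.symm.map_rel_iff.2 h))
    (hom_ext fun v => by simp) (hom_ext fun v => by simp)

end RAAG

/-- Conjugate automorphisms have isomorphic fixed subgroups. -/
def fixSubgroupCongr {G H : Type*} [Group G] [Group H] (e : G ≃* H) (φ : G ≃* G) :
    fixSubgroup φ ≃* fixSubgroup ((e.symm.trans φ).trans e) :=
  (e.subgroupMap (fixSubgroup φ)).trans (MulEquiv.subgroupCongr (by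
    ext x
    refine Subgroup.mem_map_equiv.trans ?_
    exact e.injective.eq_iff.symm.trans (by simp [fixSubgroup])))

/-- For every `g`, some right-angled Artin group on a finite simple graph
admits an involutive automorphism whose fixed subgroup is isomorphic to the genus-`g`
surface group. -/
theorem surface_group_is_fixed_subgroup (g : ℕ) :
    ∃ (n : ℕ) (Λ : SimpleGraph (Fin n)) (φ : RAAG Λ ≃* RAAG Λ),
      (∀ x : RAAG Λ, φ (φ x) = x) ∧
      Nonempty (fixSubgroup φ ≃* SurfaceGroup g) := by
  let e := RAAG.congr (SimpleGraph.overFinIso (RAAG.coneOn (RAAG.coned g) (RAAG.twistSet g)) rfl)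
  refine ⟨_, _, (e.symm.trans (RAAG.twistEquiv g)).trans e, fun x => ?_,
    ⟨((RAAG.surfaceEquiv g).trans (fixSubgroupCongr e _)).symm⟩⟩
  have h : RAAG.twistEquiv g (RAAG.twistEquiv g (e.symm x)) = e.symm x :=
    RAAG.coneTwist_coneTwist (RAAG.coneData_coned g) _
  simp [h]
end
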